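/- Let k ≥ 1 and 0 < a < 1/3. For x ∈ (0,1) set r_n(x) := l_n(x) − n·φ(a). Then M_{k,a} has a finite derivative at x if and only if r_n(x) + k·|C₀(a)|·log n → −∞ as n → ∞, and in that case M_{k,a}'(x) = 0. -/

import Mathlib

open Filter Topology MeasureTheory Set
open scoped ENNReal

/-- The `(n+1)`-th ternary digit of `x` (choosing the expansion ending in all `0`s
when two expansions exist, and the all-`2`s expansion for `x = 1`). -/
noncomputable def tDigit (x : ℝ) (n : ℕ) : ℕ :=
  if x = 1 then 2 else (⌊(3:ℝ) ^ (n + 1) * x⌋ - 3 * ⌊(3:ℝ) ^ n * x⌋).toNat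

/-- `l_n(x)`: the number of `1`s among the first `n` ternary digits of `x`. -/
noncomputable def lCount (x : ℝ) (n : ℕ) : ℕ :=
  ((Finset.range n).filter (fun i => tDigit x i = 1)).card

/-- `q_a(d)` with `q_a(0)=0`, `q_a(1)=a`, `q_a(2)=1-a`. -/
noncomputable def qDig (a : ℝ) (d : ℕ) : ℝ :=
  if d = 0 then 0 else if d = 1 then a else 1 - a

/-- Okamoto's function `F_a`. -/
noncomputable def Okamoto (a x : ℝ) : ℝ :=
  ∑' n : ℕ, a ^ (n - lCount x n) * (1 - 2 * a) ^ lCount x n * qDig a (tDigit x n)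

/-- `M_{k,a}(x)`: the `k`-th partial derivative of `F_a(x)` with respect to `a`. -/
noncomputable def Mfun (k : ℕ) (a x : ℝ) : ℝ :=
  iteratedDeriv k (fun b => Okamoto b x) a

/-- `f` has derivative `+∞` at `x` (difference quotients over `y ∈ [0,1] \ {x}`). -/
def derivPInf (f : ℝ → ℝ) (x : ℝ) : Prop :=
  Tendsto (fun y => (f y - f x) / (y - x)) (𝓝[Set.Icc 0 1 \ {x}] x) atTop

/-- `f` has derivative `-∞` at `x`. -/
def derivMInf (f : ℝ → ℝ) (x : ℝ) : Prop :=
  Tendsto (fun y => (f y - f x) / (y - x)) (𝓝[Set.Icc 0 1 \ {x}] x) atBot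

noncomputable def phiOk (a : ℝ) : ℝ :=
  if a = 1/3 then 1/3 else if a = 1/2 then 0
  else Real.log (3 * a) / (Real.log a - Real.log |1 - 2 * a|)

noncomputable def C0 (a : ℝ) : ℝ := 1 / (Real.log a - Real.log |1 - 2 * a|)

noncomputable def hEnt (p : ℝ) : ℝ :=
  (-(p * Real.log p) - (1 - p) * Real.log (1 - p) + (1 - p) * Real.log 2) / Real.log 3

noncomputable def dOk (a : ℝ) : ℝ := hEnt (phiOk a)

noncomputable def dTilde (a : ℝ) : ℝ := hEnt (1 - 2 * a)

/-- The number of `1`s among the last `n` ternary digits of `j`. -/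
def oneCount : ℕ → ℕ → ℕ
  | 0, _ => 0
  | n + 1, j => oneCount n (j / 3) + if j % 3 = 1 then 1 else 0

lemma oneCount_le (n j : ℕ) : oneCount n j ≤ n := by
  induction n generalizing j with
  | zero => simp [oneCount]
  | succ n ih =>
    have := ih (j / 3)
    simp only [oneCount]
    split_ifs <;> omega

lemma oneCount_succ_adjacent (n j : ℕ) :
    oneCount n (j + 1) ≤ oneCount n j + 1 ∧ oneCount n j ≤ oneCount n (j + 1) + 1 := by
  induction n generalizing j with
  | zero => simp [oneCount]
  | succ n ih =>
    simp only [oneCount]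
    rcases (by omega : j % 3 = 0 ∨ j % 3 = 1 ∨ j % 3 = 2) with h | h | h
    · rw [show (j + 1) / 3 = j / 3 by omega, show (j + 1) % 3 = 1 by omega, h]
      simp
      omega
    · rw [show (j + 1) / 3 = j / 3 by omega, show (j + 1) % 3 = 2 by omega, h]
      simp
      omega
    · rw [show (j + 1) / 3 = j / 3 + 1 by omega, show (j + 1) % 3 = 0 by omega, h]
      simpa using ih (j / 3)

lemma lCount_succ (x : ℝ) (n : ℕ) :
    lCount x (n + 1) = lCount x n + if tDigit x n = 1 then 1 else 0 := by
  unfold lCount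
  rw [Finset.range_add_one, Finset.filter_insert]
  split_ifs <;> simp

lemma lCount_le (x : ℝ) (n : ℕ) : lCount x n ≤ n := by
  induction n with
  | zero => simp [lCount]
  | succ n ih => rw [lCount_succ]; split_ifs <;> omega

lemma lCount_eq_sum (x : ℝ) (n : ℕ) :
    lCount x n = ∑ i ∈ Finset.range n, if tDigit x i = 1 then 1 else 0 := by
  simp [lCount]

lemma natFloor_three_pow_succ {x : ℝ} (h0 : 0 ≤ x) (h1 : x < 1) (n : ℕ) :
    ⌊(3:ℝ) ^ (n + 1) * x⌋₊ = 3 * ⌊(3:ℝ) ^ n * x⌋₊ + tDigit x n ∧ tDigit x n < 3 := by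
  have hy : 0 ≤ (3:ℝ) ^ n * x := by positivity
  have hlo := Nat.floor_le hy
  have hhi := Nat.lt_floor_add_one ((3:ℝ) ^ n * x)
  have hy' : 0 ≤ (3:ℝ) ^ (n + 1) * x := by positivity
  have e : (3:ℝ) ^ (n + 1) * x = 3 * ((3:ℝ) ^ n * x) := by ring
  have a1 : 3 * ⌊(3:ℝ) ^ n * x⌋₊ ≤ ⌊(3:ℝ) ^ (n + 1) * x⌋₊ := by
    apply Nat.le_floor
    push_cast
    linarith
  have a2 : ⌊(3:ℝ) ^ (n + 1) * x⌋₊ < 3 * ⌊(3:ℝ) ^ n * x⌋₊ + 3 := by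
    rw [Nat.floor_lt hy']
    push_cast
    linarith
  have ht : tDigit x n = ⌊(3:ℝ) ^ (n + 1) * x⌋₊ - 3 * ⌊(3:ℝ) ^ n * x⌋₊ := by
    unfold tDigit
    rw [if_neg h1.ne, ← Int.natCast_floor_eq_floor hy, ← Int.natCast_floor_eq_floor hy']
    omega
  omega

lemma lCount_eq_oneCount {x : ℝ} (h0 : 0 ≤ x) (h1 : x < 1) (n : ℕ) :
    lCount x n = oneCount n ⌊(3:ℝ) ^ n * x⌋₊ := by
  induction n with
  | zero => simp [lCount, oneCount]
  | succ n ih =>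
    obtain ⟨h, h'⟩ := natFloor_three_pow_succ h0 h1 n
    rw [lCount_succ, ih, oneCount, h, show (3 * ⌊(3:ℝ) ^ n * x⌋₊ + tDigit x n) / 3
      = ⌊(3:ℝ) ^ n * x⌋₊ by omega, show (3 * ⌊(3:ℝ) ^ n * x⌋₊ + tDigit x n) % 3
      = tDigit x n by omega]

lemma tDigit_cons_zero {t : ℝ} (h0 : 0 ≤ t) (h1 : t < 1) {d : ℕ} (hd : d < 3) :
    tDigit ((d + t) / 3) 0 = d := by
  have hd' : (d:ℝ) ≤ 2 := by exact_mod_cast Nat.lt_succ_iff.mp hd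
  have hd0 : (0:ℝ) ≤ d := by positivity
  have h := (natFloor_three_pow_succ (x := (d + t) / 3) (by positivity) (by linarith) 0).1
  have e1 : ⌊(3:ℝ) ^ (0 + 1) * ((d + t) / 3)⌋₊ = d := by
    rw [Nat.floor_eq_iff (by positivity)]
    constructor <;> norm_num <;> linarith
  have e2 : ⌊(3:ℝ) ^ 0 * ((d + t) / 3)⌋₊ = 0 := by
    rw [Nat.floor_eq_zero]
    norm_num
    linarith
  omega

lemma tDigit_cons_succ {t : ℝ} (h1 : t < 1) {d : ℕ} (hd : d < 3) (n : ℕ) :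
    tDigit ((d + t) / 3) (n + 1) = tDigit t n := by
  have hd' : (d:ℝ) ≤ 2 := by exact_mod_cast Nat.lt_succ_iff.mp hd
  unfold tDigit
  rw [if_neg (by linarith), if_neg (by linarith)]
  have e1 : (3:ℝ) ^ (n + 1 + 1) * ((d + t) / 3) = ((3 ^ (n + 1) * d : ℤ) : ℝ) + 3 ^ (n + 1) * t := by
    push_cast
    ring
  have e2 : (3:ℝ) ^ (n + 1) * ((d + t) / 3) = ((3 ^ n * d : ℤ) : ℝ) + 3 ^ n * t := by
    push_cast
    ring
  rw [e1, e2, Int.floor_intCast_add, Int.floor_intCast_add]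
  congr 1
  ring

lemma lCount_cons_succ {t : ℝ} (h0 : 0 ≤ t) (h1 : t < 1) {d : ℕ} (hd : d < 3) (n : ℕ) :
    lCount ((d + t) / 3) (n + 1) = lCount t n + if d = 1 then 1 else 0 := by
  rw [lCount_eq_sum, Finset.sum_range_succ', lCount_eq_sum, tDigit_cons_zero h0 h1 hd]
  simp only [tDigit_cons_succ h1 hd]

lemma tDigit_zero (n : ℕ) : tDigit 0 n = 0 := by
  simp [tDigit]

lemma lCount_one (n : ℕ) : lCount 1 n = 0 := by
  simp [lCount, tDigit]

/-- The initial value `q_z(d)` at a complex parameter. -/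
noncomputable def offsetC (z : ℂ) (d : ℕ) : ℂ :=
  if d = 0 then 0 else if d = 1 then z else 1 - z

/-- The height factor of the `d`-th third. -/
noncomputable def slopeC (z : ℂ) (d : ℕ) : ℂ :=
  if d = 1 then 1 - 2 * z else z

/-- The product of the height factors over `n` digits, `l` of which are equal to `1`. -/
noncomputable def weightC (n l : ℕ) (z : ℂ) : ℂ :=
  z ^ (n - l) * (1 - 2 * z) ^ l

/-- Okamoto's function at a complex parameter. -/
noncomputable def OkamotoC (z : ℂ) (x : ℝ) : ℂ :=
  ∑' n : ℕ, weightC n (lCount x n) z * offsetC z (tDigit x n)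

lemma Okamoto_eq_OkamotoC (b x : ℝ) : (Okamoto b x : ℂ) = OkamotoC b x := by
  unfold Okamoto OkamotoC
  rw [Complex.ofReal_tsum]
  refine tsum_congr fun n => ?_
  unfold qDig offsetC weightC
  split_ifs <;> push_cast <;> ring

lemma weightC_succ {n l d : ℕ} (h : l ≤ n) (z : ℂ) :
    weightC (n + 1) (l + if d = 1 then 1 else 0) z = weightC n l z * slopeC z d := by
  unfold weightC slopeC
  split_ifs
  · rw [Nat.add_sub_add_right]
    ring
  · rw [add_zero, Nat.sub_add_comm h]
    ring

lemma norm_OkamotoC_term_le {z : ℂ} {ρ : ℝ} (hz : ‖z‖ ≤ ρ) (hz' : ‖1 - 2 * z‖ ≤ ρ)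
    (hρ : ρ < 1) (x : ℝ) (n : ℕ) :
    ‖weightC n (lCount x n) z * offsetC z (tDigit x n)‖ ≤ ρ ^ n * 2 := by
  have hρ0 : 0 ≤ ρ := (norm_nonneg z).trans hz
  have h1 : ‖weightC n (lCount x n) z‖ ≤ ρ ^ n := by
    rw [weightC, norm_mul, norm_pow, norm_pow]
    calc _ ≤ ρ ^ (n - lCount x n) * ρ ^ lCount x n := by gcongr
      _ = ρ ^ n := by rw [← pow_add, Nat.sub_add_cancel (lCount_le x n)]
  have h2 : ‖offsetC z (tDigit x n)‖ ≤ 2 := by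
    have := norm_sub_le (1:ℂ) z
    rw [norm_one] at this
    unfold offsetC
    split_ifs
    · simp
    · linarith
    · linarith
  rw [norm_mul]
  gcongr

lemma summable_OkamotoC {z : ℂ} (hz : ‖z‖ < 1) (hz' : ‖1 - 2 * z‖ < 1) (x : ℝ) :
    Summable fun n : ℕ => weightC n (lCount x n) z * offsetC z (tDigit x n) := by
  have hρ : max ‖z‖ ‖1 - 2 * z‖ < 1 := max_lt hz hz'
  exact Summable.of_norm_bounded ((summable_geometric_of_lt_one
    ((norm_nonneg z).trans (le_max_left _ _)) hρ).mul_right 2)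
    fun n => norm_OkamotoC_term_le (le_max_left _ _) (le_max_right _ _) hρ x n

lemma norm_OkamotoC_le {z : ℂ} {ρ : ℝ} (hz : ‖z‖ ≤ ρ) (hz' : ‖1 - 2 * z‖ ≤ ρ)
    (hρ : ρ < 1) (x : ℝ) : ‖OkamotoC z x‖ ≤ (1 - ρ)⁻¹ * 2 :=
  tsum_of_norm_bounded ((hasSum_geometric_of_lt_one ((norm_nonneg z).trans hz) hρ).mul_right 2)
    fun n => norm_OkamotoC_term_le hz hz' hρ x n

lemma OkamotoC_zero (z : ℂ) : OkamotoC z 0 = 0 := by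
  simp [OkamotoC, tDigit_zero, offsetC]

lemma OkamotoC_one {z : ℂ} (hz : ‖z‖ < 1) : OkamotoC z 1 = 1 := by
  have hz1 : 1 - z ≠ 0 := by
    intro h
    rw [← sub_eq_zero.mp h] at hz
    simp at hz
  simp [OkamotoC, lCount_one, tDigit, offsetC, weightC, tsum_mul_right,
    tsum_geometric_of_norm_lt_one hz, hz1]

lemma OkamotoC_cons_of_lt {z : ℂ} (hz : ‖z‖ < 1) (hz' : ‖1 - 2 * z‖ < 1) {t : ℝ} (h0 : 0 ≤ t)
    (h1 : t < 1) {d : ℕ} (hd : d < 3) :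
    OkamotoC z ((d + t) / 3) = offsetC z d + slopeC z d * OkamotoC z t := by
  unfold OkamotoC
  rw [(summable_OkamotoC hz hz' _).tsum_eq_zero_add, ← tsum_mul_left]
  congr 1
  · simp [weightC, lCount, tDigit_cons_zero h0 h1 hd]
  · refine tsum_congr fun n => ?_
    rw [lCount_cons_succ h0 h1 hd, weightC_succ (lCount_le t n), tDigit_cons_succ h1 hd]
    ring

lemma OkamotoC_cons {z : ℂ} (hz : ‖z‖ < 1) (hz' : ‖1 - 2 * z‖ < 1) {t : ℝ}
    (ht : t ∈ Icc (0:ℝ) 1) {d : ℕ} (hd : d < 3) :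
    OkamotoC z ((d + t) / 3) = offsetC z d + slopeC z d * OkamotoC z t := by
  rcases ht.2.eq_or_lt with rfl | h1
  · have key := fun e (he : e < 3) => OkamotoC_cons_of_lt hz hz' le_rfl one_pos he
    interval_cases d
    · have := key 1 (by norm_num)
      simp only [OkamotoC_zero, OkamotoC_one hz, offsetC, slopeC] at this ⊢
      norm_num at this ⊢
      exact this
    · have := key 2 (by norm_num)
      simp only [OkamotoC_zero, OkamotoC_one hz, offsetC, slopeC] at this ⊢
      norm_num at this ⊢
      rw [this]
      ring
    · norm_num [OkamotoC_one hz, offsetC, slopeC]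
  · exact OkamotoC_cons_of_lt hz hz' ht.1 h1 hd

lemma OkamotoC_triadic {z : ℂ} (hz : ‖z‖ < 1) (hz' : ‖1 - 2 * z‖ < 1) (n : ℕ) {j : ℕ}
    (hj : j < 3 ^ n) {t : ℝ} (ht : t ∈ Icc (0:ℝ) 1) :
    OkamotoC z ((j + t) / 3 ^ n)
      = OkamotoC z (j / 3 ^ n) + weightC n (oneCount n j) z * OkamotoC z t := by
  induction n generalizing j t with
  | zero =>
    obtain rfl : j = 0 := by simpa using hj
    simp [oneCount, weightC, OkamotoC_zero]
  | succ n ih =>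
    have hd : j % 3 < 3 := Nat.mod_lt _ (by norm_num)
    have hd' : ((j % 3 : ℕ) : ℝ) ≤ 2 := by exact_mod_cast Nat.lt_succ_iff.mp hd
    have hd0 : (0:ℝ) ≤ ((j % 3 : ℕ) : ℝ) := by positivity
    have hj' : j / 3 < 3 ^ n := by
      rw [pow_succ] at hj
      omega
    have hjr : (j : ℝ) = 3 * ((j / 3 : ℕ) : ℝ) + ((j % 3 : ℕ) : ℝ) := by
      exact_mod_cast (Nat.div_add_mod j 3).symm
    have split : ∀ s : ℝ, s ∈ Icc (0:ℝ) 1 → OkamotoC z ((j + s) / 3 ^ (n + 1))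
        = OkamotoC z ((j / 3 : ℕ) / 3 ^ n) + weightC n (oneCount n (j / 3)) z *
          (offsetC z (j % 3) + slopeC z (j % 3) * OkamotoC z s) := by
      intro s hs
      rw [← OkamotoC_cons hz hz' hs hd, ← ih hj' ⟨by have := hs.1; positivity, by linarith [hs.2]⟩]
      congr 1
      rw [hjr, pow_succ]
      field_simp
      ring
    have h0 := split 0 (by simp)
    rw [add_zero, OkamotoC_zero] at h0
    rw [split t ht, h0, oneCount, weightC_succ (oneCount_le n _)]
    ring

lemma norm_le_of_mem_ball {a : ℝ} (ha : 0 < a) (ha' : a < 1/3) {z : ℂ}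
    (hz : z ∈ Metric.ball (a:ℂ) (a / 2)) : ‖z‖ ≤ 1 - a ∧ ‖1 - 2 * z‖ ≤ 1 - a := by
  rw [mem_ball_iff_norm] at hz
  have ha1 : ‖(a:ℂ)‖ = a := by simp [abs_of_pos ha]
  have ha2 : ‖(1 - 2 * a : ℂ)‖ = 1 - 2 * a := by
    rw [show (1 - 2 * a : ℂ) = ((1 - 2 * a : ℝ) : ℂ) by push_cast; ring, Complex.norm_real,
      Real.norm_of_nonneg (by linarith)]
  constructor
  · have := norm_add_le (a:ℂ) (z - a)
    rw [add_sub_cancel, ha1] at this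
    linarith
  · have := norm_sub_le (1 - 2 * a : ℂ) (2 * (z - a))
    rw [show (1 - 2 * a : ℂ) - 2 * (z - a) = 1 - 2 * z by ring, ha2, norm_mul] at this
    norm_num at this
    linarith

lemma differentiableOn_OkamotoC {a : ℝ} (ha : 0 < a) (ha' : a < 1/3) (x : ℝ) :
    DifferentiableOn ℂ (fun z => OkamotoC z x) (Metric.ball (a:ℂ) (a / 2)) := by
  unfold OkamotoC
  refine Complex.differentiableOn_tsum_of_summable_norm
    (u := fun n => (1 - a) ^ n * 2)
    ((summable_geometric_of_lt_one (by linarith) (by linarith)).mul_right 2)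
    (fun n => ?_) Metric.isOpen_ball
    (fun n z hz => norm_OkamotoC_term_le (norm_le_of_mem_ball ha ha' hz).1
      (norm_le_of_mem_ball ha ha' hz).2 (by linarith) x n)
  unfold weightC offsetC
  split_ifs <;> fun_prop

lemma iteratedDeriv_eq_of_complex {U : Set ℂ} (hU : IsOpen U) {f : ℂ → ℂ}
    (hf : DifferentiableOn ℂ f U) {g : ℝ → ℝ} (hfg : ∀ b : ℝ, (b:ℂ) ∈ U → (g b : ℂ) = f b)
    (k : ℕ) {b : ℝ} (hb : (b:ℂ) ∈ U) :
    ((iteratedDeriv k g b : ℝ) : ℂ) = iteratedDeriv k f b := by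
  induction k generalizing f g with
  | zero => simpa using hfg b hb
  | succ k ih =>
    rw [iteratedDeriv_succ', iteratedDeriv_succ']
    refine ih (hf.deriv hU) fun c hc => ?_
    have h1 := ((hf c hc).differentiableAt (hU.mem_nhds hc)).hasDerivAt
    have hev : (fun y : ℝ => ((g y : ℝ) : ℂ)) =ᶠ[𝓝 c] fun y => f y := by
      filter_upwards [(hU.preimage Complex.continuous_ofReal).mem_nhds hc] with y hy
      exact hfg y hy
    have h2 := h1.comp_ofReal.congr_of_eventuallyEq hev
    have h3 : HasDerivAt g (deriv f c).re c := by
      refine h1.real_of_complex.congr_of_eventuallyEq ?_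
      filter_upwards [hev] with y hy
      rw [← hy, Complex.ofReal_re]
    have h4 := h3.ofReal_comp
    rw [h3.deriv]
    exact h4.unique h2

lemma contDiffAt_Okamoto {a : ℝ} (ha : 0 < a) (ha' : a < 1/3) (x : ℝ) (k : ℕ) :
    ContDiffAt ℝ k (fun b => Okamoto b x) a := by
  have h := ((differentiableOn_OkamotoC ha ha' x).contDiffOn (n := k) Metric.isOpen_ball).contDiffAt
    (Metric.ball_mem_nhds (a:ℂ) (half_pos ha))
  convert! h.real_of_complex using 2 with b
  rw [← Okamoto_eq_OkamotoC, Complex.ofReal_re]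

lemma Mfun_sub {a : ℝ} (ha : 0 < a) (ha' : a < 1/3) (k : ℕ) (u v : ℝ) :
    Mfun k a u - Mfun k a v = iteratedDeriv k (fun b => Okamoto b u - Okamoto b v) a :=
  (iteratedDeriv_sub (contDiffAt_Okamoto ha ha' u k) (contDiffAt_Okamoto ha ha' v k)).symm

lemma OkamotoC_sub_triadic {a : ℝ} (ha : 0 < a) (ha' : a < 1/3) {z : ℂ}
    (hz : z ∈ Metric.ball (a:ℂ) (a / 2)) {n j : ℕ} (hj : j < 3 ^ n) {s t : ℝ}
    (hs : s ∈ Icc (0:ℝ) 1) (ht : t ∈ Icc (0:ℝ) 1) :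
    OkamotoC z ((j + s) / 3 ^ n) - OkamotoC z ((j + t) / 3 ^ n)
      = weightC n (oneCount n j) z * (OkamotoC z s - OkamotoC z t) := by
  obtain ⟨h1, h2⟩ := norm_le_of_mem_ball ha ha' hz
  rw [OkamotoC_triadic (by linarith) (by linarith) n hj hs,
    OkamotoC_triadic (by linarith) (by linarith) n hj ht]
  ring

/-- The product of the height factors as a polynomial in the parameter. -/
noncomputable def weightPoly (n l : ℕ) : Polynomial ℝ :=
  Polynomial.X ^ (n - l) * (1 - 2 * Polynomial.X) ^ l

lemma iteratedDeriv_polynomial (p : Polynomial ℝ) (k : ℕ) (b : ℝ) :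
    iteratedDeriv k (fun y => p.eval y) b = (Polynomial.derivative^[k] p).eval b := by
  induction k generalizing p with
  | zero => simp
  | succ k ih =>
    rw [iteratedDeriv_succ', Function.iterate_succ_apply, ← ih]
    congr 1
    ext y
    exact p.deriv

lemma Mfun_triadic_increment {a : ℝ} (ha : 0 < a) (ha' : a < 1/3) (k : ℕ) {n j : ℕ}
    (hj : j < 3 ^ n) :
    Mfun k a ((j + 1) / 3 ^ n) - Mfun k a (j / 3 ^ n)
      = (Polynomial.derivative^[k] (weightPoly n (oneCount n j))).eval a := by
  rw [Mfun_sub ha ha', ← iteratedDeriv_polynomial]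
  apply Filter.EventuallyEq.iteratedDeriv_eq
  have hmem : (fun b : ℝ => (b:ℂ)) ⁻¹' Metric.ball (a:ℂ) (a / 2) ∈ 𝓝 a :=
    (Metric.isOpen_ball.preimage Complex.continuous_ofReal).mem_nhds
      (Metric.mem_ball_self (half_pos ha))
  filter_upwards [hmem] with b hb
  have h := OkamotoC_sub_triadic ha ha' hb hj (s := 1) (t := 0) (by simp) (by simp)
  rw [OkamotoC_zero, OkamotoC_one (by linarith [(norm_le_of_mem_ball ha ha' hb).1]), add_zero,
    ← Okamoto_eq_OkamotoC, ← Okamoto_eq_OkamotoC] at h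
  apply Complex.ofReal_injective
  push_cast
  rw [h]
  simp [weightPoly, weightC]

lemma norm_weightC_le {a : ℝ} (ha : 0 < a) (ha' : a < 1/3) {n l : ℕ} (hl : l ≤ n) {δ : ℝ} {z : ℂ}
    (hz : ‖z - a‖ ≤ δ) :
    ‖weightC n l z‖ ≤ Real.exp (2 * n * δ / a) * (a ^ (n - l) * (1 - 2 * a) ^ l) := by
  have hδ : 0 ≤ δ := (norm_nonneg _).trans hz
  have h2a : a ≤ 1 - 2 * a := by linarith
  have hq : 0 ≤ δ / a := by positivity
  have e1 : ‖z‖ ≤ Real.exp (2 * δ / a) * a := by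
    have h := norm_add_le (a:ℂ) (z - a)
    rw [add_sub_cancel, Complex.norm_real, Real.norm_of_nonneg ha.le] at h
    have : (2 * δ / a + 1) * a ≤ Real.exp (2 * δ / a) * a := by
      gcongr
      exact Real.add_one_le_exp _
    have e : (2 * δ / a + 1) * a = 2 * δ + a := by field_simp
    linarith
  have e2 : ‖1 - 2 * z‖ ≤ Real.exp (2 * δ / a) * (1 - 2 * a) := by
    have h := norm_sub_le (1 - 2 * a : ℂ) (2 * (z - a))
    rw [show (1 - 2 * a : ℂ) - 2 * (z - a) = 1 - 2 * z by ring, norm_mul,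
      show (1 - 2 * a : ℂ) = ((1 - 2 * a : ℝ) : ℂ) by push_cast; ring, Complex.norm_real,
      Real.norm_of_nonneg (by linarith)] at h
    norm_num at h
    have : (2 * δ / a + 1) * (1 - 2 * a) ≤ Real.exp (2 * δ / a) * (1 - 2 * a) := by
      gcongr
      · linarith
      · exact Real.add_one_le_exp _
    have e : (2 * δ / a) * a ≤ (2 * δ / a) * (1 - 2 * a) := by gcongr
    rw [div_mul_cancel₀ _ ha.ne'] at e
    linarith
  rw [weightC, norm_mul, norm_pow, norm_pow]
  calc _ ≤ (Real.exp (2 * δ / a) * a) ^ (n - l) * (Real.exp (2 * δ / a) * (1 - 2 * a)) ^ l := by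
        gcongr
    _ = Real.exp (2 * δ / a) ^ (n - l + l) * (a ^ (n - l) * (1 - 2 * a) ^ l) := by
        rw [mul_pow, mul_pow, pow_add]
        ring
    _ = _ := by
        rw [Nat.sub_add_cancel hl, ← Real.exp_nat_mul]
        congr 2
        ring

/-- On a triadic interval of order `n`, the oscillation of `M_{k,a}` is at most a constant times
`n ^ k` times the height of that interval. -/
lemma abs_Mfun_sub_le {a : ℝ} (ha : 0 < a) (ha' : a < 1/3) (k : ℕ) :
    ∃ C : ℝ, 0 ≤ C ∧ ∀ n j : ℕ, 1 ≤ n → j < 3 ^ n → ∀ u v : ℝ,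
      u ∈ Icc ((j:ℝ) / 3 ^ n) ((j + 1) / 3 ^ n) → v ∈ Icc ((j:ℝ) / 3 ^ n) ((j + 1) / 3 ^ n) →
      |Mfun k a u - Mfun k a v|
        ≤ C * (n ^ k * (a ^ (n - oneCount n j) * (1 - 2 * a) ^ oneCount n j)) := by
  refine ⟨k.factorial * (Real.exp 1 * (4 / a)) * (4 / a) ^ k, by positivity, ?_⟩
  intro n j hn hj u v hu hv
  have hn' : (1:ℝ) ≤ n := by exact_mod_cast hn
  have h3 : (0:ℝ) < 3 ^ n := by positivity
  have param : ∀ w : ℝ, w ∈ Icc ((j:ℝ) / 3 ^ n) ((j + 1) / 3 ^ n) →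
      ∃ s ∈ Icc (0:ℝ) 1, w = (j + s) / 3 ^ n := by
    intro w hw
    refine ⟨3 ^ n * w - j, ⟨?_, ?_⟩, ?_⟩
    · have := (div_le_iff₀ h3).mp hw.1
      linarith
    · have := (le_div_iff₀ h3).mp hw.2
      linarith
    · field_simp
      ring
  obtain ⟨s, hs, rfl⟩ := param u hu
  obtain ⟨t, ht, rfl⟩ := param v hv
  set δ : ℝ := a / (4 * n) with hδ
  have hδ0 : 0 < δ := by positivity
  have hδa : δ < a / 2 := by
    rw [hδ, div_lt_div_iff₀ (by positivity) (by positivity)]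
    nlinarith
  set f : ℂ → ℂ := fun z => OkamotoC z ((j + s) / 3 ^ n) - OkamotoC z ((j + t) / 3 ^ n) with hf
  have hfd : DifferentiableOn ℂ f (Metric.ball (a:ℂ) (a / 2)) :=
    (differentiableOn_OkamotoC ha ha' _).sub (differentiableOn_OkamotoC ha ha' _)
  have hreal := iteratedDeriv_eq_of_complex Metric.isOpen_ball hfd
    (g := fun b => Okamoto b ((j + s) / 3 ^ n) - Okamoto b ((j + t) / 3 ^ n))
    (fun b _ => by simp [hf, Okamoto_eq_OkamotoC]) k (b := a)
    (Metric.mem_ball_self (half_pos ha))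
  rw [← Mfun_sub ha ha'] at hreal
  have hsub : Metric.closedBall (a:ℂ) δ ⊆ Metric.ball (a:ℂ) (a / 2) :=
    Metric.closedBall_subset_ball hδa
  have hcl : DiffContOnCl ℂ f (Metric.ball (a:ℂ) δ) :=
    DifferentiableOn.diffContOnCl (by
      rw [closure_ball _ hδ0.ne']
      exact hfd.mono hsub)
  have hbound : ∀ z ∈ Metric.sphere (a:ℂ) δ, ‖f z‖
      ≤ Real.exp 1 * (a ^ (n - oneCount n j) * (1 - 2 * a) ^ oneCount n j) * (4 / a) := by
    intro z hz
    have hzb := hsub (Metric.sphere_subset_closedBall hz)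
    obtain ⟨h1, h2⟩ := norm_le_of_mem_ball ha ha' hzb
    rw [hf]
    simp only
    rw [OkamotoC_sub_triadic ha ha' hzb hj hs ht, norm_mul]
    have b1 : ‖OkamotoC z s - OkamotoC z t‖ ≤ 4 / a := by
      refine (norm_sub_le _ _).trans ((add_le_add (norm_OkamotoC_le h1 h2 (by linarith) s)
        (norm_OkamotoC_le h1 h2 (by linarith) t)).trans_eq ?_)
      rw [sub_sub_cancel]
      ring
    have b2 := norm_weightC_le ha ha' (oneCount_le n j) (z := z) (δ := δ)
      (by rw [← mem_sphere_iff_norm.mp hz])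
    have b3 : Real.exp (2 * n * δ / a) ≤ Real.exp 1 := by
      apply Real.exp_le_exp.mpr
      rw [hδ]
      field_simp
      norm_num
    have hW : 0 ≤ a ^ (n - oneCount n j) * (1 - 2 * a) ^ oneCount n j := by
      have : 0 ≤ 1 - 2 * a := by linarith
      positivity
    exact mul_le_mul (b2.trans (mul_le_mul_of_nonneg_right b3 hW)) b1 (norm_nonneg _)
      (mul_nonneg (Real.exp_pos 1).le hW)
  have hC := Complex.norm_iteratedDeriv_le_of_forall_mem_sphere_norm_le k hδ0 hcl hbound
  rw [← hreal, Complex.norm_real, Real.norm_eq_abs] at hC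
  refine hC.trans_eq ?_
  rw [hδ, show a / (4 * (n:ℝ)) = ((4 / a) * n)⁻¹ by field_simp, inv_pow, div_inv_eq_mul, mul_pow]
  ring

open Polynomial in
lemma derivative_weightPoly (n l : ℕ) (hl : l ≤ n) :
    (X * (1 - 2 * X)) * derivative (weightPoly n l)
      = (C ((n:ℝ) - l) - C (2 * (n:ℝ)) * X) * weightPoly n l := by
  obtain ⟨m, rfl⟩ := Nat.exists_eq_add_of_le' hl
  have h1 : X * derivative (X ^ m : ℝ[X]) = C (m:ℝ) * X ^ m := by
    rcases m with _ | m
    · simp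
    · rw [derivative_X_pow, Nat.add_sub_cancel]
      ring
  have h2 : (1 - 2 * X) * derivative ((1 - 2 * X : ℝ[X]) ^ l)
      = C (-2 * (l:ℝ)) * (1 - 2 * X) ^ l := by
    have hd : derivative (1 - 2 * X : ℝ[X]) = -2 := by
      simp
    rcases l with _ | l
    · simp
    · rw [derivative_pow, Nat.add_sub_cancel, hd]
      simp only [C_mul, C_neg, map_natCast, map_ofNat]
      ring
  rw [weightPoly, Nat.add_sub_cancel, derivative_mul]
  simp only [C_mul, C_neg, C_sub, C_add, map_natCast, map_ofNat, Nat.cast_add] at h1 h2 ⊢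
  linear_combination (1 - 2 * X) ^ l * (1 - 2 * X) * h1 + X ^ m * X * h2

open Polynomial in
lemma iterate_derivative_weightPoly (n l : ℕ) (hl : l ≤ n) (j : ℕ) :
    (X * (1 - 2 * X)) * derivative^[j + 2] (weightPoly n l)
      = (C ((n:ℝ) - l) - C (2 * (n:ℝ)) * X - ((j:ℝ[X]) + 1) * (1 - 4 * X))
          * derivative^[j + 1] (weightPoly n l)
        - (2 * (n:ℝ[X]) * ((j:ℝ[X]) + 1) - 2 * ((j:ℝ[X]) + 1) * (j:ℝ[X])) * derivative^[j] (weightPoly n l) := by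
  induction j with
  | zero =>
    have h := congrArg derivative (derivative_weightPoly n l hl)
    simp only [derivative_mul, derivative_sub, derivative_X, derivative_one, derivative_ofNat,
      derivative_C] at h
    simp only [C_mul, C_sub, map_natCast, map_ofNat] at h ⊢
    simp only [Function.iterate_succ_apply', Function.iterate_zero, id_eq]
    push_cast
    linear_combination h
  | succ j ih =>
    have h := congrArg derivative ih
    simp only [derivative_mul, derivative_sub, derivative_add, derivative_X, derivative_one,
      derivative_ofNat, derivative_natCast, derivative_C, ← Function.iterate_succ_apply'] at h
    simp only [C_mul, C_sub, map_natCast, map_ofNat] at h ⊢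
    push_cast
    linear_combination h

open Polynomial in
lemma iterate_derivative_mul_of_derivative_derivative_eq_zero (p g : ℝ[X])
    (hg : derivative (derivative g) = 0) (j : ℕ) :
    derivative^[j + 1] (p * g)
      = derivative^[j + 1] p * g + ((j:ℝ[X]) + 1) * derivative^[j] p * derivative g := by
  induction j with
  | zero => simp [derivative_mul]
  | succ j ih =>
    rw [Function.iterate_succ_apply', ih]
    simp only [derivative_mul, derivative_add, derivative_one, derivative_natCast, hg,
      ← Function.iterate_succ_apply']
    push_cast
    ring

/-- The `j`-th derivative at `a` of the product of height factors. -/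
noncomputable def weightDeriv (a : ℝ) (j n l : ℕ) : ℝ :=
  (Polynomial.derivative^[j] (weightPoly n l)).eval a

lemma weightDeriv_zero (a : ℝ) (n l : ℕ) :
    weightDeriv a 0 n l = a ^ (n - l) * (1 - 2 * a) ^ l := by
  simp [weightDeriv, weightPoly]

open Polynomial in
/-- The two possible height factors `a` and `1 - 2 * a` both have the form
`1 / 3 + g' * (a - 1 / 3)`, where `g'` is the derivative of the factor. -/
lemma weightDeriv_succ_digit (a : ℝ) (n l : ℕ) (hl : l ≤ n) (e : ℕ) (he : e = 0 ∨ e = 1) :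
    ∃ g' : ℝ, 1 ≤ |g'| ∧
      weightDeriv a 0 (n + 1) (l + e) = (1 / 3 + g' * (a - 1 / 3)) * weightDeriv a 0 n l ∧
      ∀ j, weightDeriv a (j + 1) (n + 1) (l + e)
        = (1 / 3 + g' * (a - 1 / 3)) * weightDeriv a (j + 1) n l
          + (j + 1) * g' * weightDeriv a j n l := by
  rcases he with rfl | rfl
  · have hP : weightPoly (n + 1) (l + 0) = weightPoly n l * X := by
      rw [weightPoly, weightPoly, add_zero, Nat.sub_add_comm hl]
      ring
    refine ⟨1, by simp, ?_, fun j => ?_⟩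
    · rw [weightDeriv, weightDeriv, hP]
      simp
      ring
    · rw [weightDeriv, hP, iterate_derivative_mul_of_derivative_derivative_eq_zero _ _ (by simp)]
      simp [weightDeriv, -Function.iterate_succ, mul_comm a]
  · have hP : weightPoly (n + 1) (l + 1) = weightPoly n l * (1 - 2 * X) := by
      rw [weightPoly, weightPoly, Nat.add_sub_add_right]
      ring
    refine ⟨-2, by norm_num, ?_, fun j => ?_⟩
    · rw [weightDeriv, weightDeriv, hP]
      simp
      ring
    · rw [weightDeriv, hP, iterate_derivative_mul_of_derivative_derivative_eq_zero _ _ (by simp)]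
      simp [weightDeriv, -Function.iterate_succ]
      ring

/-- If the rescaled `k`-th derivatives converge along a digit sequence, then they and all the lower
order ones tend to `0`. -/
lemma tendsto_weightDeriv_zero {a : ℝ} (ha' : a < 1/3) {l : ℕ → ℕ}
    (hl : ∀ n, l n ≤ n) (hl' : ∀ n, ∃ e, (e = 0 ∨ e = 1) ∧ l (n + 1) = l n + e) (k : ℕ) {d : ℝ}
    (h : Tendsto (fun n => 3 ^ n * weightDeriv a k n (l n)) atTop (𝓝 d)) :
    ∀ j ≤ k, Tendsto (fun n => 3 ^ n * weightDeriv a j n (l n)) atTop (𝓝 0) := by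
  have hne : a - 1 / 3 ≠ 0 := by linarith
  have hstep : ∀ n, ∃ g' : ℝ, 1 ≤ |g'| ∧
      weightDeriv a 0 (n + 1) (l (n + 1)) = (1 / 3 + g' * (a - 1 / 3)) * weightDeriv a 0 n (l n) ∧
      ∀ j, weightDeriv a (j + 1) (n + 1) (l (n + 1))
        = (1 / 3 + g' * (a - 1 / 3)) * weightDeriv a (j + 1) n (l n)
          + (j + 1) * g' * weightDeriv a j n (l n) := by
    intro n
    obtain ⟨e, he, h1⟩ := hl' n
    rw [h1]
    exact weightDeriv_succ_digit a n (l n) (hl n) e he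
  choose g hg hg0 hgs using hstep
  set v : ℕ → ℕ → ℝ := fun j n => 3 ^ n * weightDeriv a j n (l n) with hv
  have small : ∀ (w u : ℕ → ℝ) (c : ℝ), Tendsto w atTop (𝓝 c) →
      (∀ n, w (n + 1) - w n = 3 * g n * u n) → Tendsto u atTop (𝓝 0) := by
    intro w u c hw hwu
    have h0 : Tendsto (fun n => w (n + 1) - w n) atTop (𝓝 0) := by
      simpa using (hw.comp (tendsto_add_atTop_nat 1)).sub hw
    refine squeeze_zero_norm (fun n => ?_) (tendsto_zero_iff_norm_tendsto_zero.mp h0)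
    rw [hwu n, Real.norm_eq_abs, Real.norm_eq_abs, abs_mul, abs_mul, Nat.abs_ofNat]
    nlinarith [hg n, abs_nonneg (u n)]
  have lower : ∀ j c, Tendsto (v (j + 1)) atTop (𝓝 c) →
      Tendsto (fun n => (a - 1 / 3) * v (j + 1) n + (j + 1) * v j n) atTop (𝓝 0) := by
    intro j c hc
    refine small _ _ c hc fun n => ?_
    simp only [hv, hgs, pow_succ]
    ring
  have conv : ∀ i ≤ k, ∃ c, Tendsto (v (k - i)) atTop (𝓝 c) := by
    intro i
    induction i with
    | zero => exact fun _ => ⟨d, h⟩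
    | succ i ih =>
      intro hi
      obtain ⟨c, hc⟩ := ih (by omega)
      obtain ⟨j, hj, hj'⟩ : ∃ j, k - i = j + 1 ∧ k - (i + 1) = j := ⟨k - (i + 1), by omega, rfl⟩
      rw [hj] at hc
      rw [hj']
      have h1 := ((lower j c hc).sub (hc.const_mul (a - 1 / 3))).const_mul ((j:ℝ) + 1)⁻¹
      refine ⟨_, h1.congr fun n => ?_⟩
      have : (j:ℝ) + 1 ≠ 0 := by positivity
      field_simp
      ring
  intro j
  induction j with
  | zero =>
    intro _
    obtain ⟨c, hc⟩ := conv k le_rfl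
    rw [Nat.sub_self] at hc
    have h1 := small (v 0) (fun n => (a - 1 / 3) * v 0 n) c hc fun n => by
      simp only [hv, hg0, pow_succ]
      ring
    have h2 := h1.const_mul (a - 1 / 3)⁻¹
    rw [mul_zero] at h2
    exact h2.congr fun n => inv_mul_cancel_left₀ hne _
  | succ j ih =>
    intro hj
    obtain ⟨c, hc⟩ := conv (k - (j + 1)) (by omega)
    rw [Nat.sub_sub_self hj] at hc
    have h1 := ((lower j c hc).sub ((ih (by omega)).const_mul ((j:ℝ) + 1))).const_mul (a - 1 / 3)⁻¹
    rw [mul_zero, sub_zero, mul_zero] at h1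
    refine h1.congr fun n => ?_
    simp only [hv]
    rw [add_sub_cancel_right, inv_mul_cancel_left₀ hne]

lemma weightDeriv_growth {a : ℝ} (ha : 0 < a) (ha' : a < 1/3) {l : ℕ → ℕ} (hl : ∀ n, l n ≤ n)
    {c : ℝ} (hc : 0 < c) (hlc : ∀ᶠ n : ℕ in atTop, c * n ≤ n - l n - 2 * n * a) (j : ℕ) :
    ∃ c' > 0, ∀ᶠ n : ℕ in atTop, 0 < weightDeriv a j n (l n) ∧
      c' * n * weightDeriv a j n (l n) ≤ weightDeriv a (j + 1) n (l n) := by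
  have hs : 0 < a * (1 - 2 * a) := mul_pos ha (by linarith)
  induction j with
  | zero =>
    refine ⟨c / (a * (1 - 2 * a)), by positivity, ?_⟩
    filter_upwards [hlc] with n hn
    have h := congrArg (Polynomial.eval a) (derivative_weightPoly n (l n) (hl n))
    have h0 : 0 < weightDeriv a 0 n (l n) := by
      rw [weightDeriv_zero]
      have : 0 < 1 - 2 * a := by linarith
      positivity
    refine ⟨h0, ?_⟩
    rw [div_mul_eq_mul_div, div_mul_eq_mul_div, div_le_iff₀ hs]
    simp at h
    have e0 : weightDeriv a 0 n (l n) = (weightPoly n (l n)).eval a := rfl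
    have e1 : weightDeriv a 1 n (l n) = (Polynomial.derivative (weightPoly n (l n))).eval a := rfl
    rw [← e0, ← e1] at h
    simp only [zero_add]
    nlinarith
  | succ j ih =>
    obtain ⟨c', hc', ih⟩ := ih
    refine ⟨c / 2 / (a * (1 - 2 * a)), by positivity, ?_⟩
    filter_upwards [hlc, ih, eventually_ge_atTop 1, tendsto_natCast_atTop_atTop.eventually_ge_atTop
      ((2 / c) * ((j + 1) + 2 * (j + 1) / c'))] with n hn ihn hn1 hbig
    obtain ⟨h0, h1⟩ := ihn
    have hn0 : (0:ℝ) < n := by exact_mod_cast hn1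
    have hpos : 0 < weightDeriv a (j + 1) n (l n) := lt_of_lt_of_le (by positivity) h1
    refine ⟨hpos, ?_⟩
    have h := congrArg (Polynomial.eval a) (iterate_derivative_weightPoly n (l n) (hl n) j)
    simp only [Polynomial.eval_mul, Polynomial.eval_sub, Polynomial.eval_add, Polynomial.eval_X,
      Polynomial.eval_one, Polynomial.eval_ofNat, Polynomial.eval_natCast, Polynomial.eval_C] at h
    rw [← weightDeriv, ← weightDeriv, ← weightDeriv] at h
    rw [div_mul_eq_mul_div, div_mul_eq_mul_div, div_le_iff₀ hs]
    have hbig' : (j + 1 : ℝ) + 2 * (j + 1) / c' ≤ c / 2 * n := by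
      calc (j + 1 : ℝ) + 2 * (j + 1) / c'
          = c / 2 * ((2 / c) * ((j + 1) + 2 * (j + 1) / c')) := by field_simp
        _ ≤ c / 2 * n := by gcongr
    have hlow : 2 * (n:ℝ) * (j + 1) * weightDeriv a j n (l n)
        ≤ 2 * (j + 1) / c' * weightDeriv a (j + 1) n (l n) := by
      calc _ = 2 * (j + 1) / c' * (c' * n * weightDeriv a j n (l n)) := by field_simp
        _ ≤ _ := by gcongr
    have hj0 : (0:ℝ) ≤ j := by positivity
    have hlow' : 0 ≤ 2 * ((j:ℝ) + 1) * j * weightDeriv a j n (l n) := by positivity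
    have hA : (c * n - (j + 1)) * weightDeriv a (j + 1) n (l n)
        ≤ (n - l n - 2 * n * a - (j + 1) * (1 - 4 * a)) * weightDeriv a (j + 1) n (l n) := by
      gcongr
      nlinarith
    have hB := mul_le_mul_of_nonneg_right hbig' hpos.le
    linarith

lemma pow_mul_weightDeriv_le {a : ℝ} (ha : 0 < a) (ha' : a < 1/3) {l : ℕ → ℕ} (hl : ∀ n, l n ≤ n)
    {c : ℝ} (hc : 0 < c) (hlc : ∀ᶠ n : ℕ in atTop, c * n ≤ n - l n - 2 * n * a) (k : ℕ) :
    ∃ c' > 0, ∀ᶠ n : ℕ in atTop,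
      c' * n ^ k * weightDeriv a 0 n (l n) ≤ weightDeriv a k n (l n) := by
  induction k with
  | zero => exact ⟨1, one_pos, by simp⟩
  | succ k ih =>
    obtain ⟨c₁, hc₁, h₁⟩ := ih
    obtain ⟨c₂, hc₂, h₂⟩ := weightDeriv_growth ha ha' hl hc hlc k
    refine ⟨c₂ * c₁, by positivity, ?_⟩
    filter_upwards [h₁, h₂] with n hn₁ hn₂
    calc c₂ * c₁ * (n:ℝ) ^ (k + 1) * weightDeriv a 0 n (l n)
        = c₂ * n * (c₁ * n ^ k * weightDeriv a 0 n (l n)) := by ring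
      _ ≤ c₂ * n * weightDeriv a k n (l n) := by gcongr
      _ ≤ _ := hn₂.2

lemma weightDeriv_zero_pos {a : ℝ} (ha : 0 < a) (ha' : a < 1/3) (n l : ℕ) :
    0 < weightDeriv a 0 n l := by
  have : 0 < 1 - 2 * a := by linarith
  rw [weightDeriv_zero]
  positivity

lemma log_three_pow_mul_weightDeriv_zero {a : ℝ} (ha : 0 < a) (ha' : a < 1/3) {n l : ℕ}
    (hl : l ≤ n) :
    Real.log (3 ^ n * weightDeriv a 0 n l)
      = l * (Real.log (1 - 2 * a) - Real.log a) + n * Real.log (3 * a) := by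
  have h2 : 0 < 1 - 2 * a := by linarith
  rw [weightDeriv_zero, Real.log_mul (by positivity) (by positivity),
    Real.log_mul (by positivity) (by positivity), Real.log_pow, Real.log_pow, Real.log_pow,
    Real.log_mul (by norm_num) ha.ne', Nat.cast_sub hl]
  ring

lemma tendsto_atBot_iff_tendsto_zero {a : ℝ} (ha : 0 < a) (ha' : a < 1/3) (k : ℕ) (x : ℝ) :
    Tendsto (fun n : ℕ =>
          ((lCount x n : ℝ) - (n : ℝ) * phiOk a) + (k : ℝ) * |C0 a| * Real.log n) atTop atBot ↔
      Tendsto (fun n : ℕ => n ^ k * (3 ^ n * weightDeriv a 0 n (lCount x n))) atTop (𝓝 0) := by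
  have hL : 0 < Real.log (1 - 2 * a) - Real.log a :=
    sub_pos.mpr (Real.log_lt_log ha (by linarith))
  have habs : |1 - 2 * a| = 1 - 2 * a := abs_of_pos (by linarith)
  have hC : |C0 a| = 1 / (Real.log (1 - 2 * a) - Real.log a) := by
    rw [C0, habs, abs_div, abs_one, abs_sub_comm, abs_of_pos hL]
  have hphi : phiOk a = -(Real.log (3 * a) / (Real.log (1 - 2 * a) - Real.log a)) := by
    rw [phiOk, if_neg ha'.ne, if_neg (by linarith), habs, ← div_neg, neg_sub]
  rw [← tendsto_mul_const_atBot_of_pos hL, ← Real.tendsto_exp_comp_nhds_zero]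
  refine tendsto_congr' ?_
  filter_upwards [eventually_gt_atTop 0] with n hn
  have hn' : (0:ℝ) < n := by exact_mod_cast hn
  have hW := weightDeriv_zero_pos ha ha' n (lCount x n)
  rw [← Real.exp_log (show 0 < (n:ℝ) ^ k * (3 ^ n * weightDeriv a 0 n (lCount x n)) by positivity),
    Real.log_mul (by positivity) (by positivity), Real.log_pow,
    log_three_pow_mul_weightDeriv_zero ha ha' (lCount_le x n), hC, hphi]
  congr 1
  generalize Real.log (1 - 2 * a) - Real.log a = L at hL ⊢
  field_simp
  ring

/-- The critical frequency of the digit `1` is less than `1 - 2 * a`. -/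
lemma neg_log_three_mul_lt {a : ℝ} (ha : 0 < a) (ha' : a < 1/3) :
    -Real.log (3 * a) < (1 - 2 * a) * (Real.log (1 - 2 * a) - Real.log a) := by
  have h2 : 0 < 1 - 2 * a := by linarith
  have h3 := Real.log_lt_sub_one_of_pos (x := (3 * a)⁻¹) (by positivity)
    (inv_eq_one.not.mpr (by linarith))
  have h4 := Real.log_le_sub_one_of_pos (x := (3 * (1 - 2 * a))⁻¹) (by positivity)
  rw [Real.log_inv, Real.log_mul (by norm_num) (by positivity)] at h3 h4
  have h5 := mul_lt_mul_of_pos_left h3 (show 0 < 2 * a by positivity)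
  have h6 := mul_le_mul_of_nonneg_left h4 h2.le
  have e5 : 2 * a * ((3 * a)⁻¹ - 1) = 2 / 3 - 2 * a := by field_simp
  have e6 : (1 - 2 * a) * ((3 * (1 - 2 * a))⁻¹ - 1) = 1 / 3 - (1 - 2 * a) := by field_simp
  rw [e5] at h5
  rw [e6] at h6
  rw [Real.log_mul (by norm_num) ha.ne']
  linarith

lemma exists_frequency_gap {a : ℝ} (ha : 0 < a) (ha' : a < 1/3) {l : ℕ → ℕ} (hl : ∀ n, l n ≤ n)
    (h : Tendsto (fun n => 3 ^ n * weightDeriv a 0 n (l n)) atTop (𝓝 0)) :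
    ∃ c > 0, ∀ᶠ n : ℕ in atTop, c * n ≤ n - l n - 2 * n * a := by
  have hL : 0 < Real.log (1 - 2 * a) - Real.log a :=
    sub_pos.mpr (Real.log_lt_log ha (by linarith))
  refine ⟨1 - 2 * a - -Real.log (3 * a) / (Real.log (1 - 2 * a) - Real.log a),
    sub_pos.mpr ((div_lt_iff₀ hL).mpr (neg_log_three_mul_lt ha ha')), ?_⟩
  filter_upwards [h.eventually_lt_const one_pos] with n hn
  have hW := weightDeriv_zero_pos ha ha' n (l n)
  have hlog := Real.log_neg (by positivity) hn
  rw [log_three_pow_mul_weightDeriv_zero ha ha' (hl n)] at hlog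
  have h1 : (l n : ℝ) ≤ -Real.log (3 * a) / (Real.log (1 - 2 * a) - Real.log a) * n := by
    rw [div_mul_eq_mul_div, le_div_iff₀ hL]
    linarith
  linarith

lemma natFloor_three_pow_lt {x : ℝ} (h0 : 0 ≤ x) (h1 : x < 1) (n : ℕ) :
    ⌊(3:ℝ) ^ n * x⌋₊ < 3 ^ n := by
  have h3 : (0:ℝ) < 3 ^ n := by positivity
  rw [Nat.floor_lt (by positivity)]
  push_cast
  nlinarith

lemma mem_triadic_interval {x : ℝ} (h0 : 0 ≤ x) (n : ℕ) :
    x ∈ Icc ((⌊(3:ℝ) ^ n * x⌋₊ : ℝ) / 3 ^ n) ((⌊(3:ℝ) ^ n * x⌋₊ + 1) / 3 ^ n) := by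
  have h3 : (0:ℝ) < 3 ^ n := by positivity
  have hlo := Nat.floor_le (show 0 ≤ (3:ℝ) ^ n * x by positivity)
  have hhi := Nat.lt_floor_add_one ((3:ℝ) ^ n * x)
  constructor
  · rw [div_le_iff₀ h3]
    linarith
  · rw [le_div_iff₀ h3]
    linarith

lemma tendsto_weightDeriv_of_hasDerivAt {a : ℝ} (ha : 0 < a) (ha' : a < 1/3) (k : ℕ) {x : ℝ}
    (h0 : 0 ≤ x) (h1 : x < 1) {d : ℝ} (h : HasDerivAt (Mfun k a) d x) :
    Tendsto (fun n => 3 ^ n * weightDeriv a k n (lCount x n)) atTop (𝓝 d) := by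
  have hgeo : Tendsto (fun n : ℕ => ((3:ℝ) ^ n)⁻¹) atTop (𝓝 0) := by
    simpa using tendsto_pow_atTop_nhds_zero_of_lt_one (r := (3:ℝ)⁻¹) (by norm_num) (by norm_num)
  have hmem := mem_triadic_interval h0
  have hlen : ∀ n : ℕ, ((⌊(3:ℝ) ^ n * x⌋₊ : ℝ) + 1) / 3 ^ n
      = (⌊(3:ℝ) ^ n * x⌋₊ : ℝ) / 3 ^ n + ((3:ℝ) ^ n)⁻¹ := fun n => by rw [add_div, one_div]
  have hleft : Tendsto (fun n : ℕ => (⌊(3:ℝ) ^ n * x⌋₊ : ℝ) / 3 ^ n) atTop (𝓝 x) := by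
    refine tendsto_of_tendsto_of_tendsto_of_le_of_le (by simpa using hgeo.const_sub x)
      tendsto_const_nhds (fun n => ?_) (fun n => (hmem n).1)
    have := (hmem n).2
    rw [hlen] at this
    simp only
    linarith
  have hright : Tendsto (fun n : ℕ => ((⌊(3:ℝ) ^ n * x⌋₊ : ℝ) + 1) / 3 ^ n) atTop (𝓝 x) := by
    simp only [hlen]
    simpa using hleft.add hgeo
  rw [hasDerivAt_iff_isLittleO, Asymptotics.isLittleO_iff] at h
  rw [Metric.tendsto_nhds]
  intro ε hε
  have hev := h (half_pos hε)
  filter_upwards [hleft.eventually hev, hright.eventually hev] with n hn hn'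
  have h3 : (0:ℝ) < 3 ^ n := by positivity
  have hinc := Mfun_triadic_increment ha ha' k (natFloor_three_pow_lt h0 h1 n)
  rw [← lCount_eq_oneCount h0 h1, ← weightDeriv] at hinc
  rw [← hinc, Real.dist_eq]
  obtain ⟨m1, m2⟩ := hmem n
  rw [smul_eq_mul, Real.norm_eq_abs, Real.norm_eq_abs] at hn hn'
  rw [abs_of_nonpos (show (⌊(3:ℝ) ^ n * x⌋₊ : ℝ) / 3 ^ n - x ≤ 0 by linarith)] at hn
  rw [abs_of_nonneg (show 0 ≤ ((⌊(3:ℝ) ^ n * x⌋₊ : ℝ) + 1) / 3 ^ n - x by linarith)] at hn'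
  have hl := hlen n
  set p : ℝ := (⌊(3:ℝ) ^ n * x⌋₊ : ℝ) / 3 ^ n with hp
  set q : ℝ := ((⌊(3:ℝ) ^ n * x⌋₊ : ℝ) + 1) / 3 ^ n with hq
  have key : |Mfun k a q - Mfun k a p - (q - p) * d| ≤ ε / 2 * (q - p) := by
    have := abs_sub (Mfun k a q - Mfun k a x - (q - x) * d) (Mfun k a p - Mfun k a x - (p - x) * d)
    rw [show Mfun k a q - Mfun k a x - (q - x) * d - (Mfun k a p - Mfun k a x - (p - x) * d)
      = Mfun k a q - Mfun k a p - (q - p) * d by ring] at this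
    linarith
  have hqp : 3 ^ n * (q - p) = 1 := by
    rw [hl, add_sub_cancel_left, mul_inv_cancel₀ h3.ne']
  calc |3 ^ n * (Mfun k a q - Mfun k a p) - d|
      = |3 ^ n * (Mfun k a q - Mfun k a p - (q - p) * d)| := by
        congr 1
        linear_combination (d : ℝ) * hqp
    _ = 3 ^ n * |Mfun k a q - Mfun k a p - (q - p) * d| := by rw [abs_mul, abs_of_pos h3]
    _ ≤ 3 ^ n * (ε / 2 * (q - p)) := by gcongr
    _ = ε / 2 := by linear_combination ε / 2 * hqp
    _ < ε := half_lt_self hε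

lemma hasDerivAt_Mfun_imp {a : ℝ} (ha : 0 < a) (ha' : a < 1/3) (k : ℕ) {x : ℝ}
    (h0 : 0 ≤ x) (h1 : x < 1) {d : ℝ} (h : HasDerivAt (Mfun k a) d x) :
    d = 0 ∧
      Tendsto (fun n : ℕ => n ^ k * (3 ^ n * weightDeriv a 0 n (lCount x n))) atTop (𝓝 0) := by
  have hd := tendsto_weightDeriv_of_hasDerivAt ha ha' k h0 h1 h
  have hall := tendsto_weightDeriv_zero ha' (lCount_le x)
    (fun n => ⟨_, by split_ifs <;> simp, lCount_succ x n⟩) k hd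
  refine ⟨tendsto_nhds_unique hd (hall k le_rfl), ?_⟩
  obtain ⟨c, hc, hlc⟩ := exists_frequency_gap ha ha' (lCount_le x) (hall 0 (Nat.zero_le k))
  obtain ⟨c', hc', hle⟩ := pow_mul_weightDeriv_le ha ha' (lCount_le x) hc hlc k
  have hlim := (hall k le_rfl).const_mul c'⁻¹
  rw [mul_zero] at hlim
  refine tendsto_of_tendsto_of_tendsto_of_le_of_le' tendsto_const_nhds hlim
    (Eventually.of_forall fun n => ?_) ?_
  · have := weightDeriv_zero_pos ha ha' n (lCount x n)
    positivity
  · filter_upwards [hle] with n hn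
    rw [← div_eq_inv_mul, le_div_iff₀ hc']
    have := mul_le_mul_of_nonneg_left hn (show (0:ℝ) ≤ 3 ^ n by positivity)
    linarith

lemma weightDeriv_zero_le_of_le_succ {a : ℝ} (ha : 0 < a) (ha' : a < 1/3) {n l l' : ℕ}
    (hl : l ≤ n) (hl' : l' ≤ n) (h : l' ≤ l + 1) :
    weightDeriv a 0 n l' ≤ (1 - 2 * a) / a * weightDeriv a 0 n l := by
  have form : ∀ m ≤ n, weightDeriv a 0 n m = a ^ n * ((1 - 2 * a) / a) ^ m := by
    intro m hm
    rw [weightDeriv_zero, pow_sub₀ a ha.ne' hm, div_pow]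
    ring
  have h1 : 1 ≤ (1 - 2 * a) / a := by
    rw [one_le_div ha]
    linarith
  rw [form l hl, form l' hl']
  calc a ^ n * ((1 - 2 * a) / a) ^ l' ≤ a ^ n * ((1 - 2 * a) / a) ^ (l + 1) := by
        gcongr
    _ = _ := by ring

lemma abs_Mfun_sub_le_of_close {a : ℝ} (ha : 0 < a) (ha' : a < 1/3) (k : ℕ) :
    ∃ C : ℝ, 0 ≤ C ∧ ∀ n : ℕ, 1 ≤ n → ∀ u v : ℝ, u ∈ Ico (0:ℝ) 1 → v ∈ Ico (0:ℝ) 1 →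
      |u - v| ≤ ((3:ℝ) ^ n)⁻¹ →
      |Mfun k a u - Mfun k a v| ≤ C * (n ^ k * weightDeriv a 0 n (lCount u n)) := by
  obtain ⟨C, hC, hosc⟩ := abs_Mfun_sub_le ha ha' k
  have symm_bound : ∀ n : ℕ, 1 ≤ n → ∀ u v : ℝ, u ∈ Ico (0:ℝ) 1 → v ∈ Ico (0:ℝ) 1 →
      |u - v| ≤ ((3:ℝ) ^ n)⁻¹ → u ≤ v →
      (lCount u n ≤ lCount v n + 1 ∧ lCount v n ≤ lCount u n + 1) ∧
      |Mfun k a u - Mfun k a v| ≤ C * (n ^ k * weightDeriv a 0 n (lCount u n))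
        + C * (n ^ k * weightDeriv a 0 n (lCount v n)) := by
    intro n hn u v hu hv huv hle
    have h3 : (0:ℝ) < 3 ^ n := by positivity
    rw [abs_sub_comm, abs_of_nonneg (sub_nonneg.mpr hle)] at huv
    have hmu := mem_triadic_interval hu.1 n
    have hmv := mem_triadic_interval hv.1 n
    have hju := natFloor_three_pow_lt hu.1 hu.2 n
    have hjv := natFloor_three_pow_lt hv.1 hv.2 n
    have hup : 0 ≤ (3:ℝ) ^ n * u := mul_nonneg h3.le hu.1
    have f1 : ⌊(3:ℝ) ^ n * u⌋₊ ≤ ⌊(3:ℝ) ^ n * v⌋₊ := Nat.floor_mono (by gcongr)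
    have f2 : ⌊(3:ℝ) ^ n * v⌋₊ ≤ ⌊(3:ℝ) ^ n * u⌋₊ + 1 := by
      rw [← Nat.floor_add_one hup]
      apply Nat.floor_mono
      have := mul_le_mul_of_nonneg_left huv h3.le
      rw [mul_inv_cancel₀ h3.ne'] at this
      linarith
    rw [lCount_eq_oneCount hu.1 hu.2, lCount_eq_oneCount hv.1 hv.2]
    set i := ⌊(3:ℝ) ^ n * u⌋₊ with hi
    set j := ⌊(3:ℝ) ^ n * v⌋₊ with hj
    have hWi := weightDeriv_zero_pos ha ha' n (oneCount n i)
    rcases (by omega : j = i ∨ j = i + 1) with hji | hji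
    · rw [hji] at hmv ⊢
      refine ⟨⟨by omega, by omega⟩, ?_⟩
      have := hosc n i hn hju u v hmu hmv
      rw [← weightDeriv_zero] at this
      have : 0 ≤ C * ((n:ℝ) ^ k * weightDeriv a 0 n (oneCount n i)) := by positivity
      linarith
    · rw [hji] at hmv hjv ⊢
      refine ⟨(oneCount_succ_adjacent n i).symm, ?_⟩
      have hstep : ((i:ℝ) / 3 ^ n) ≤ (i + 1) / 3 ^ n := by
        gcongr
        linarith
      have hstep' : (((i + 1 : ℕ):ℝ) / 3 ^ n) ≤ (((i + 1 : ℕ):ℝ) + 1) / 3 ^ n := by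
        gcongr
        linarith
      have b1 := hosc n i hn hju u ((i + 1) / 3 ^ n) hmu ⟨hstep, le_rfl⟩
      have b2 := hosc n (i + 1) hn hjv ((i + 1) / 3 ^ n) v ⟨by push_cast; rfl, by
        push_cast at hstep' ⊢; exact hstep'⟩ hmv
      rw [← weightDeriv_zero] at b1 b2
      exact (abs_sub_le _ (Mfun k a ((i + 1) / 3 ^ n)) _).trans (add_le_add b1 b2)
  refine ⟨C * (1 + (1 - 2 * a) / a), ?_, ?_⟩
  · have : 0 < 1 - 2 * a := by linarith
    positivity
  intro n hn u v hu hv huv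
  obtain ⟨hcount, hb⟩ : lCount v n ≤ lCount u n + 1 ∧
      |Mfun k a u - Mfun k a v| ≤ C * (n ^ k * weightDeriv a 0 n (lCount u n))
        + C * (n ^ k * weightDeriv a 0 n (lCount v n)) := by
    rcases le_total u v with hle | hle
    · have h := symm_bound n hn u v hu hv huv hle
      exact ⟨h.1.2, h.2⟩
    · have h := symm_bound n hn v u hv hu (by rwa [abs_sub_comm]) hle
      exact ⟨h.1.1, by rw [abs_sub_comm, add_comm]; exact h.2⟩
  have hW := weightDeriv_zero_le_of_le_succ ha ha' (lCount_le u n) (lCount_le v n) hcount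
  have : C * (n ^ k * weightDeriv a 0 n (lCount v n))
      ≤ C * (n ^ k * ((1 - 2 * a) / a * weightDeriv a 0 n (lCount u n))) := by gcongr
  linarith

lemma hasDerivAt_Mfun_zero {a : ℝ} (ha : 0 < a) (ha' : a < 1/3) (k : ℕ) {x : ℝ}
    (hx : x ∈ Ioo (0:ℝ) 1)
    (h : Tendsto (fun n : ℕ => n ^ k * (3 ^ n * weightDeriv a 0 n (lCount x n))) atTop (𝓝 0)) :
    HasDerivAt (Mfun k a) 0 x := by
  obtain ⟨C, hC, hclose⟩ := abs_Mfun_sub_le_of_close ha ha' k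
  rw [hasDerivAt_iff_isLittleO, Asymptotics.isLittleO_iff]
  intro ε hε
  have hlim := h.const_mul (C * 3)
  rw [mul_zero] at hlim
  obtain ⟨N, hN⟩ := eventually_atTop.mp (hlim.eventually_le_const hε)
  have hr : (0:ℝ) < (1 / 3) ^ (N + 1) := by positivity
  filter_upwards [Ioo_mem_nhds hx.1 hx.2, Metric.ball_mem_nhds x hr] with y hy hyx
  rw [smul_zero, sub_zero, Real.norm_eq_abs, Real.norm_eq_abs]
  rcases eq_or_ne y x with rfl | hne
  · simp
  rw [Metric.mem_ball, Real.dist_eq] at hyx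
  have hpos : 0 < |y - x| := abs_pos.mpr (sub_ne_zero.mpr hne)
  obtain ⟨n, hn1, hn2⟩ := exists_nat_pow_near_of_lt_one (y := (1 / 3 : ℝ)) hpos
    (hyx.le.trans (pow_le_one₀ (by norm_num) (by norm_num))) (by norm_num) (by norm_num)
  have hNn : N + 1 < n + 1 :=
    (pow_lt_pow_iff_right_of_lt_one₀ (by norm_num) (by norm_num)).mp (hn1.trans hyx)
  have hb := hclose n (by omega) x y ⟨hx.1.le, hx.2⟩ ⟨hy.1.le, hy.2⟩
    (by rw [abs_sub_comm]; simpa using hn2)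
  have hsmall := hN n (by omega)
  rw [abs_sub_comm]
  have h3 : (0:ℝ) < 3 ^ n := by positivity
  have h1 : 1 ≤ 3 * 3 ^ n * |y - x| := by
    rw [one_div, inv_pow, inv_lt_iff_one_lt_mul₀ (by positivity), pow_succ] at hn1
    linarith
  have hW := weightDeriv_zero_pos ha ha' n (lCount x n)
  calc |Mfun k a x - Mfun k a y| ≤ C * (n ^ k * weightDeriv a 0 n (lCount x n)) := hb
    _ ≤ C * (n ^ k * weightDeriv a 0 n (lCount x n)) * (3 * 3 ^ n * |y - x|) :=
        le_mul_of_one_le_right (by positivity) h1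
    _ = C * 3 * (n ^ k * (3 ^ n * weightDeriv a 0 n (lCount x n))) * |y - x| := by ring
    _ ≤ ε * |y - x| := by gcongr

/-- for `k ≥ 1` and `0 < a < 1/3`, `M_{k,a}` has a finite derivative at
`x ∈ (0,1)` iff `r_n(x) + k|C₀(a)| log n → -∞`, in which case the derivative is `0`. -/
theorem stmt3 (k : ℕ) (hk : 1 ≤ k) (a : ℝ) (ha : 0 < a) (ha' : a < 1/3)
    (x : ℝ) (hx : x ∈ Set.Ioo (0:ℝ) 1) :
    ((∃ d : ℝ, HasDerivAt (Mfun k a) d x) ↔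
      Tendsto (fun n : ℕ =>
          ((lCount x n : ℝ) - (n : ℝ) * phiOk a) + (k : ℝ) * |C0 a| * Real.log n)
        atTop atBot) ∧
    ∀ d : ℝ, HasDerivAt (Mfun k a) d x → d = 0 := by
  rw [tendsto_atBot_iff_tendsto_zero ha ha' k x]
  exact ⟨⟨fun ⟨_, hd⟩ => (hasDerivAt_Mfun_imp ha ha' k hx.1.le hx.2 hd).2,
    fun h => ⟨0, hasDerivAt_Mfun_zero ha ha' k hx h⟩⟩,
    fun _ hd => (hasDerivAt_Mfun_imp ha ha' k hx.1.le hx.2 hd).1⟩
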